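/- arXiv:2303.13925 — 5 statements merged into one kernel-verified Lean document; each statement's English description precedes it below -/
import Mathlib

section
/- Bosonic contraction formula (Lemma 3.3, discrete-mode form): for all n_A, m_A, n_B, m_B ∈ ℕ and all finitely supported kernels f_A : (Fin n_A → ι) × (Fin m_A → ι) → ℂ and f_B : (Fin n_B → ι) × (Fin m_B → ι) → ℂ, one has Op(f_A) * Op(f_B) = :Op(f_A)Op(f_B): + Op(f_A) Γ Op(f_B). -/
open scoped Classical

noncomputable section

variable {ι : Type*} [DecidableEq ι] {R : Type*} [Ring R] [Algebra ℂ R]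

/-- `FOp a adag f` is the normal ordered operator
`Σ_{(X,Y)} f(X,Y) · a⁺_{X n} ⋯ a⁺_{X 1} · a_{Y 1} ⋯ a_{Y m}` associated with a finitely
supported kernel `f`. -/
def FOp (a adag : ι → R) {n m : ℕ} (f : ((Fin n → ι) × (Fin m → ι)) →₀ ℂ) : R :=
  f.sum fun XY c =>
    c • ((List.ofFn fun i => adag (XY.1 i)).reverse.prod *
         (List.ofFn fun j => a (XY.2 j)).prod)

/-- The normal ordered product `:Op(f_A)Op(f_B):`. -/
def FNormal (a adag : ι → R) {nA mA nB mB : ℕ}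
    (fA : ((Fin nA → ι) × (Fin mA → ι)) →₀ ℂ)
    (fB : ((Fin nB → ι) × (Fin mB → ι)) →₀ ℂ) : R :=
  fA.sum fun XYA cA => fB.sum fun XYB cB =>
    (cA * cB) •
      ((List.ofFn fun i => adag (XYA.1 i)).reverse.prod *
       (List.ofFn fun i => adag (XYB.1 i)).reverse.prod *
       (List.ofFn fun j => a (XYA.2 j)).prod *
       (List.ofFn fun j => a (XYB.2 j)).prod)

/-- The bosonic attached product `Op(f_A) Γ Op(f_B)`: a sum over all contraction
configurations `(π, π')`, where `π` (strictly decreasing) picks left connectors of `B`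
and `π'` (injective) picks right connectors of `A`. Uncontracted connectors keep their
order (contracted ones are replaced by the unit `1` inside the ordered products). -/
def FAttachB (a adag : ι → R) {nA mA nB mB : ℕ}
    (fA : ((Fin nA → ι) × (Fin mA → ι)) →₀ ℂ)
    (fB : ((Fin nB → ι) × (Fin mB → ι)) →₀ ℂ) : R :=
  ∑ C ∈ Finset.Icc 1 (min mA nB),
    ∑ π ∈ Finset.univ.filter (fun π : Fin C → Fin nB => StrictAnti π),
      ∑ π' ∈ Finset.univ.filter (fun π' : Fin C → Fin mA => Function.Injective π'),
        fA.sum fun XYA cA => fB.sum fun XYB cB =>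
          (cA * cB * ∏ c : Fin C, if XYB.1 (π c) = XYA.2 (π' c) then (1 : ℂ) else 0) •
            ((List.ofFn fun i => adag (XYA.1 i)).reverse.prod *
             (List.ofFn fun i : Fin nB =>
                if ∃ c, π c = i then (1 : R) else adag (XYB.1 i)).reverse.prod *
             (List.ofFn fun j : Fin mA =>
                if ∃ c, π' c = j then (1 : R) else a (XYA.2 j)).prod *
             (List.ofFn fun j => a (XYB.2 j)).prod)

/-- Moving `d` to the left through an ordered product whose factors have scalar commutator
with `d`. -/
lemma prod_ofFn_mul_of_commutator {m : ℕ} (b : Fin m → R) (d : R) (c : Fin m → ℂ)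
    (h : ∀ j, b j * d = d * b j + c j • 1) :
    (List.ofFn b).prod * d =
      d * (List.ofFn b).prod + ∑ j, c j • (List.ofFn (Function.update b j 1)).prod := by
  induction m with
  | zero => simp
  | succ m ih =>
    have ih' := ih (fun j => b j.succ) (fun j => c j.succ) fun j => h j.succ
    have h0 : (fun i : Fin m => Function.update b 0 1 i.succ) = fun i => b i.succ := by
      funext i
      exact Function.update_of_ne (Fin.succ_ne_zero i) _ _
    have hs (j : Fin m) : (fun i : Fin m => Function.update b j.succ 1 i.succ) =
        Function.update (fun i => b i.succ) j 1 :=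
      Function.update_comp_eq_of_injective b (Fin.succ_injective m) j 1
    have hs0 (j : Fin m) : Function.update b j.succ 1 0 = b 0 :=
      Function.update_of_ne (Fin.succ_ne_zero j).symm _ _
    simp only [List.ofFn_succ, List.prod_cons, Fin.sum_univ_succ, h0, hs, hs0,
      Function.update_self, one_mul]
    rw [mul_assoc, ih', mul_add, ← mul_assoc, h 0, add_mul, Finset.mul_sum]
    simp only [mul_smul_comm, smul_mul_assoc, one_mul, mul_assoc, add_assoc]

/-- The partial map `g` is injective where it is defined. -/
def IsPartialInj {α β : Type*} (g : α → Option β) : Prop :=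
  ∀ i k j, g i = some j → g k = some j → i = k

/-- The pairing weight of a partial contraction: the product over the contracted positions of
the indicators that the two modes agree. -/
def pairingWeight {n m : ℕ} (X : Fin n → ι) (Y : Fin m → ι) (g : Fin n → Option (Fin m)) : ℂ :=
  ∏ i, (g i).elim 1 fun j => if X i = Y j then (1 : ℂ) else 0

lemma isPartialInj_cons_none {n : ℕ} {β : Type*} (g : Fin n → Option β) :
    IsPartialInj (Fin.cons none g : Fin (n + 1) → Option β) ↔ IsPartialInj g := by
  constructor
  · intro h i i' j hi hi'
    exact Fin.succ_injective _ (h i.succ i'.succ j (by simpa using hi) (by simpa using hi'))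
  · intro h i i' j
    refine Fin.cases ?_ (fun i => ?_) i
    · simp
    · refine Fin.cases ?_ (fun i' => ?_) i'
      · simp
      · simpa using h i i' j

lemma isPartialInj_cons_some {n : ℕ} {β : Type*} (b : β) (g : Fin n → Option β) :
    IsPartialInj (Fin.cons (some b) g : Fin (n + 1) → Option β) ↔
      IsPartialInj g ∧ ¬∃ i, g i = some b := by
  constructor
  · intro h
    refine ⟨fun i i' j hi hi' =>
      Fin.succ_injective _ (h i.succ i'.succ j (by simpa using hi) (by simpa using hi')), ?_⟩
    rintro ⟨i, hi⟩
    exact Fin.succ_ne_zero i (h i.succ 0 b (by simpa using hi) (by simp))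
  · rintro ⟨h, hb⟩ i i' j
    push Not at hb
    refine Fin.cases ?_ (fun i => ?_) i
    · refine Fin.cases ?_ (fun i' => ?_) i'
      · simp
      · simp only [Fin.cons_zero, Fin.cons_succ, Option.some.injEq]
        rintro rfl hi'
        exact absurd hi' (hb i')
    · refine Fin.cases ?_ (fun i' => ?_) i'
      · simp only [Fin.cons_zero, Fin.cons_succ, Option.some.injEq]
        rintro hi rfl
        exact absurd hi (hb i)
      · simp only [Fin.cons_succ, Fin.succ_inj]
        exact h _ _ _

/-- Wick expansion of an ordered product of annihilators times creators, as a sum over partial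
injections. -/
lemma prod_mul_prod_eq_sum_isPartialInj (a adag : ι → R)
    (hccr : ∀ i j, a i * adag j - adag j * a i = if i = j then 1 else 0)
    {n m : ℕ} (X : Fin n → ι) (Y : Fin m → ι) :
    (List.ofFn fun j => a (Y j)).prod * (List.ofFn fun i => adag (X i)).reverse.prod =
      ∑ g : Fin n → Option (Fin m), if IsPartialInj g then pairingWeight X Y g •
        ((List.ofFn fun i => if (g i).isSome then (1 : R) else adag (X i)).reverse.prod *
         (List.ofFn fun j => if ∃ i, g i = some j then (1 : R) else a (Y j)).prod) else 0 := by
  induction n with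
  | zero => simp [IsPartialInj, pairingWeight]
  | succ n ih =>
    have comm (g : Fin n → Option (Fin m)) :
        (List.ofFn fun j => if ∃ i, g i = some j then (1 : R) else a (Y j)).prod * adag (X 0) =
        adag (X 0) * (List.ofFn fun j => if ∃ i, g i = some j then (1 : R) else a (Y j)).prod +
        ∑ j, if ∃ i, g i = some j then 0 else (if X 0 = Y j then (1 : ℂ) else 0) •
          (List.ofFn fun j' => if j = j' ∨ ∃ i, g i = some j' then (1 : R) else a (Y j')).prod := by
      rw [prod_ofFn_mul_of_commutator _ _
        (fun j => if ∃ i, g i = some j then 0 else if X 0 = Y j then (1 : ℂ) else 0)]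
      · congr 1
        refine Finset.sum_congr rfl fun j _ => ?_
        split_ifs with h1 h2
        · simp
        · congr 3
          funext j'
          by_cases hj : j = j'
          · subst hj; simp
          · simp [Function.update_of_ne (Ne.symm hj), hj]
        · simp
      · intro j
        split_ifs with h1 h2
        · simp
        · have := hccr (Y j) (X 0)
          rw [if_pos h2.symm, sub_eq_iff_eq_add] at this
          rw [this, one_smul, add_comm]
        · have := hccr (Y j) (X 0)
          rw [if_neg (Ne.symm h2), sub_eq_iff_eq_add] at this
          rw [this, zero_smul, add_comm]
    have hsum (F : (Fin (n + 1) → Option (Fin m)) → R) :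
        ∑ g, F g = ∑ g : Fin n → Option (Fin m), ∑ o, F (Fin.cons o g) := by
      rw [← (Fin.consEquiv fun _ : Fin (n + 1) => Option (Fin m)).sum_comp,
        Fintype.sum_prod_type_right]
      rfl
    rw [hsum, List.ofFn_succ, List.reverse_cons, List.prod_append, ← mul_assoc, ih, Finset.sum_mul]
    refine Finset.sum_congr rfl fun g _ => ?_
    rw [Fintype.sum_option]
    by_cases hg : IsPartialInj g
    · simp only [isPartialInj_cons_none, isPartialInj_cons_some, hg, true_and,
        if_true, pairingWeight, Fin.prod_univ_succ, Fin.exists_fin_succ, List.ofFn_succ,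
        Fin.cons_zero, Fin.cons_succ, Option.elim_none, Option.elim_some, one_mul,
        Option.isSome_none, Option.isSome_some, Bool.false_eq_true, if_false, List.reverse_cons,
        List.prod_append, List.prod_singleton, mul_one, reduceCtorEq, false_or,
        Option.some.injEq]
      rw [smul_mul_assoc, mul_assoc, comm, mul_add, smul_add, mul_assoc, Finset.mul_sum,
        Finset.smul_sum]
      congr 1
      refine Finset.sum_congr rfl fun j _ => ?_
      by_cases hj : ∃ i, g i = some j
      · simp only [hj, not_true_eq_false, if_true, if_false, mul_zero, smul_zero]
      · simp only [hj, not_false_eq_true, if_true, if_false]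
        rw [mul_smul_comm, smul_smul, mul_comm]
    · simp [isPartialInj_cons_none, isPartialInj_cons_some, hg]

/-- The partial injection `π c ↦ π' c` of a contraction configuration. -/
def contractionMap {C n m : ℕ} (π : Fin C → Fin n) (π' : Fin C → Fin m) :
    Fin n → Option (Fin m) :=
  Function.extend π (fun c => some (π' c)) fun _ => none

lemma contractionMap_apply {C n m : ℕ} {π : Fin C → Fin n} (hπ : Function.Injective π)
    (π' : Fin C → Fin m) (c : Fin C) : contractionMap π π' (π c) = some (π' c) :=
  hπ.extend_apply _ _ c

lemma contractionMap_eq_some {C n m : ℕ} {π : Fin C → Fin n} (hπ : Function.Injective π)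
    (π' : Fin C → Fin m) {i : Fin n} {j : Fin m} :
    contractionMap π π' i = some j ↔ ∃ c, π c = i ∧ π' c = j := by
  constructor
  · intro h
    by_cases hi : ∃ c, π c = i
    · obtain ⟨c, rfl⟩ := hi
      rw [contractionMap_apply hπ] at h
      exact ⟨c, rfl, Option.some.inj h⟩
    · rw [contractionMap, Function.extend_apply' _ _ _ hi] at h
      cases h
  · rintro ⟨c, rfl, rfl⟩
    exact contractionMap_apply hπ π' c

lemma isSome_contractionMap {C n m : ℕ} {π : Fin C → Fin n} (hπ : Function.Injective π)
    (π' : Fin C → Fin m) (i : Fin n) :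
    (contractionMap π π' i).isSome ↔ ∃ c, π c = i := by
  simp only [Option.isSome_iff_exists, contractionMap_eq_some hπ]
  exact ⟨fun ⟨_, c, hc, _⟩ => ⟨c, hc⟩, fun ⟨c, hc⟩ => ⟨_, c, hc, rfl⟩⟩

lemma pairingWeight_contractionMap {C n m : ℕ} (X : Fin n → ι) (Y : Fin m → ι)
    {π : Fin C → Fin n} (hπ : Function.Injective π) (π' : Fin C → Fin m) :
    pairingWeight X Y (contractionMap π π') =
      ∏ c, if X (π c) = Y (π' c) then (1 : ℂ) else 0 := by
  refine (Fintype.prod_of_injective π hπ _ _ (fun i hi => ?_) fun c => ?_).symm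
  · rw [contractionMap, Function.extend_apply' _ _ _ hi, Option.elim_none]
  · rw [contractionMap_apply hπ, Option.elim_some]

lemma isPartialInj_contractionMap {C n m : ℕ} {π : Fin C → Fin n} (hπ : Function.Injective π)
    {π' : Fin C → Fin m} (hπ' : Function.Injective π') :
    IsPartialInj (contractionMap π π') := by
  intro i i' j hi hi'
  obtain ⟨c, rfl, hc⟩ := (contractionMap_eq_some hπ π').1 hi
  obtain ⟨d, rfl, hd⟩ := (contractionMap_eq_some hπ π').1 hi'
  exact congrArg π (hπ' (hc.trans hd.symm))

/-- Every partial injection comes from a contraction configuration. -/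
lemma exists_contractionMap_eq {n m : ℕ} {g : Fin n → Option (Fin m)} (hg : IsPartialInj g) :
    ∃ (C : ℕ) (π : Fin C → Fin n) (π' : Fin C → Fin m),
      StrictAnti π ∧ Function.Injective π' ∧ contractionMap π π' = g := by
  set S : Finset (Fin n) := Finset.univ.filter fun i => (g i).isSome with hS
  set π : Fin S.card → Fin n := fun c => S.orderEmbOfFin rfl c.rev with hπdef
  have hπ : StrictAnti π := fun c d hcd =>
    (S.orderEmbOfFin rfl).strictMono (Fin.rev_lt_rev.2 hcd)
  have hmem (c) : (g (π c)).isSome :=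
    (Finset.mem_filter.1 (S.orderEmbOfFin_mem rfl c.rev)).2
  have hsome (c) : g (π c) = some ((g (π c)).get (hmem c)) := (Option.some_get _).symm
  refine ⟨S.card, π, fun c => (g (π c)).get (hmem c), hπ, fun c d hcd => ?_, ?_⟩
  · refine hπ.injective (hg _ _ _ (hsome c) ?_)
    rw [hsome d]
    exact congrArg some hcd.symm
  · funext i
    by_cases hi : ∃ c, π c = i
    · obtain ⟨c, rfl⟩ := hi
      rw [contractionMap_apply hπ.injective, ← hsome]
    · rw [contractionMap, Function.extend_apply' _ _ _ hi]
      by_contra hne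
      have hiS : i ∈ S := by
        simp only [hS, Finset.mem_filter, Finset.mem_univ, true_and]
        exact Option.isSome_iff_ne_none.2 (Ne.symm hne)
      obtain ⟨c, hc⟩ : i ∈ Set.range (S.orderEmbOfFin rfl) := by
        rw [Finset.range_orderEmbOfFin]; exact hiS
      exact hi ⟨c.rev, by simpa [hπdef] using hc⟩

/-- The partial injection determines the contraction configuration. -/
lemma contractionMap_inj {C D n m : ℕ} {π : Fin C → Fin n} {π' : Fin C → Fin m}
    {ρ : Fin D → Fin n} {ρ' : Fin D → Fin m} (hπ : StrictAnti π) (hρ : StrictAnti ρ)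
    (h : contractionMap π π' = contractionMap ρ ρ') :
    (⟨C, π, π'⟩ : Σ C : ℕ, (Fin C → Fin n) × (Fin C → Fin m)) = ⟨D, ρ, ρ'⟩ := by
  have hrange : Set.range π = Set.range ρ := by
    ext i
    exact (isSome_contractionMap hπ.injective π' i).symm.trans
      (h ▸ isSome_contractionMap hρ.injective ρ' i)
  obtain rfl : C = D := by
    simpa [Set.card_range_of_injective hπ.injective, Set.card_range_of_injective hρ.injective]
      using Fintype.card_congr (Equiv.setCongr hrange)
  obtain rfl : π = ρ := (hπ.range_inj hρ).1 hrange
  obtain rfl : π' = ρ' := by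
    funext c
    have hc := congrFun h (π c)
    rw [contractionMap_apply hπ.injective, contractionMap_apply hρ.injective] at hc
    exact Option.some.inj hc
  rfl

/-- Reindexing a sum over partial injections as a sum over contraction configurations. -/
lemma sum_isPartialInj_eq_sum_contraction {n m : ℕ} {M : Type*} [AddCommMonoid M]
    (F : (Fin n → Option (Fin m)) → M) :
    (∑ g, if IsPartialInj g then F g else 0) =
      ∑ C ∈ Finset.Icc 0 (min m n),
        ∑ π ∈ Finset.univ.filter (fun π : Fin C → Fin n => StrictAnti π),
          ∑ π' ∈ Finset.univ.filter (fun π' : Fin C → Fin m => Function.Injective π'),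
            F (contractionMap π π') := by
  simp_rw [← Finset.sum_product']
  rw [← Finset.sum_filter, Finset.sum_sigma']
  symm
  refine Finset.sum_bij (fun x _ => contractionMap x.2.1 x.2.2) ?_ ?_ ?_ fun _ _ => rfl
  · rintro ⟨C, π, π'⟩ hx
    simp only [Finset.mem_sigma, Finset.mem_product, Finset.mem_filter, Finset.mem_univ,
      true_and] at hx ⊢
    exact isPartialInj_contractionMap hx.2.1.injective hx.2.2
  · rintro ⟨C, π, π'⟩ hx ⟨D, ρ, ρ'⟩ hy h
    simp only [Finset.mem_sigma, Finset.mem_product, Finset.mem_filter, Finset.mem_univ,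
      true_and] at hx hy
    exact contractionMap_inj hx.2.1 hy.2.1 h
  · intro g hg
    obtain ⟨C, π, π', hπ, hπ', rfl⟩ := exists_contractionMap_eq (Finset.mem_filter.1 hg).2
    refine ⟨⟨C, π, π'⟩, ?_, rfl⟩
    have h1 : C ≤ n := by simpa using Fintype.card_le_of_injective π hπ.injective
    have h2 : C ≤ m := by simpa using Fintype.card_le_of_injective π' hπ'
    simp [hπ', hπ, h1, h2]

/-- Wick expansion of an ordered product of annihilators times creators, with the uncontracted
term split off. -/
lemma prod_mul_prod_eq_add_sum_contraction (a adag : ι → R)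
    (hccr : ∀ i j, a i * adag j - adag j * a i = if i = j then 1 else 0)
    {n m : ℕ} (X : Fin n → ι) (Y : Fin m → ι) :
    (List.ofFn fun j => a (Y j)).prod * (List.ofFn fun i => adag (X i)).reverse.prod =
      (List.ofFn fun i => adag (X i)).reverse.prod * (List.ofFn fun j => a (Y j)).prod +
      ∑ C ∈ Finset.Icc 1 (min m n),
        ∑ π ∈ Finset.univ.filter (fun π : Fin C → Fin n => StrictAnti π),
          ∑ π' ∈ Finset.univ.filter (fun π' : Fin C → Fin m => Function.Injective π'),
            (∏ c, if X (π c) = Y (π' c) then (1 : ℂ) else 0) •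
            ((List.ofFn fun i => if ∃ c, π c = i then (1 : R) else adag (X i)).reverse.prod *
             (List.ofFn fun j => if ∃ c, π' c = j then (1 : R) else a (Y j)).prod) := by
  have hterm (C : ℕ) (π : Fin C → Fin n) (hπ : StrictAnti π) (π' : Fin C → Fin m) :
      pairingWeight X Y (contractionMap π π') •
        ((List.ofFn fun i => if (contractionMap π π' i).isSome then (1 : R)
            else adag (X i)).reverse.prod *
         (List.ofFn fun j => if ∃ i, contractionMap π π' i = some j then (1 : R)
            else a (Y j)).prod) =
      (∏ c, if X (π c) = Y (π' c) then (1 : ℂ) else 0) •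
        ((List.ofFn fun i => if ∃ c, π c = i then (1 : R) else adag (X i)).reverse.prod *
         (List.ofFn fun j => if ∃ c, π' c = j then (1 : R) else a (Y j)).prod) := by
    have hr (j : Fin m) : (∃ i, contractionMap π π' i = some j) ↔ ∃ c, π' c = j := by
      simp only [contractionMap_eq_some hπ.injective]
      exact ⟨fun ⟨_, c, _, hc⟩ => ⟨c, hc⟩, fun ⟨c, hc⟩ => ⟨_, c, rfl, hc⟩⟩
    simp only [pairingWeight_contractionMap X Y hπ.injective, hr,
      isSome_contractionMap hπ.injective]
  have hIcc : Finset.Icc 0 (min m n) = insert 0 (Finset.Icc 1 (min m n)) := by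
    ext C
    simp only [Finset.mem_Icc, Finset.mem_insert]
    omega
  rw [prod_mul_prod_eq_sum_isPartialInj a adag hccr, sum_isPartialInj_eq_sum_contraction]
  rw [Finset.sum_congr rfl fun C _ => Finset.sum_congr rfl fun π hπ =>
    Finset.sum_congr rfl fun π' _ => hterm C π (Finset.mem_filter.1 hπ).2 π']
  rw [hIcc, Finset.sum_insert (by simp)]
  congr 1
  have hanti : ∀ π : Fin 0 → Fin n, StrictAnti π := fun _ c => c.elim0
  have hinj : ∀ π' : Fin 0 → Fin m, Function.Injective π' := fun _ c => c.elim0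
  simp [hanti, hinj]

/-- **Bosonic contraction formula** (Lemma 3.3, discrete-mode form):
if `a, a⁺` satisfy the CCR, then `Op(f_A) Op(f_B) = :Op(f_A)Op(f_B): + Op(f_A) Γ Op(f_B)`. -/
theorem bosonic_contraction_formula (a adag : ι → R)
    (hccr1 : ∀ i j, a i * adag j - adag j * a i = if i = j then 1 else 0)
    (hccr2 : ∀ i j, a i * a j = a j * a i)
    (hccr3 : ∀ i j, adag i * adag j = adag j * adag i)
    {nA mA nB mB : ℕ}
    (fA : ((Fin nA → ι) × (Fin mA → ι)) →₀ ℂ)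
    (fB : ((Fin nB → ι) × (Fin mB → ι)) →₀ ℂ) :
    FOp a adag fA * FOp a adag fB = FNormal a adag fA fB + FAttachB a adag fA fB := by
  have hatt : FAttachB a adag fA fB =
      fA.sum fun XYA cA => fB.sum fun XYB cB => (cA * cB) •
        ((List.ofFn fun i => adag (XYA.1 i)).reverse.prod *
          (∑ C ∈ Finset.Icc 1 (min mA nB),
            ∑ π ∈ Finset.univ.filter (fun π : Fin C → Fin nB => StrictAnti π),
              ∑ π' ∈ Finset.univ.filter (fun π' : Fin C → Fin mA => Function.Injective π'),
                (∏ c, if XYB.1 (π c) = XYA.2 (π' c) then (1 : ℂ) else 0) •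
                ((List.ofFn fun i => if ∃ c, π c = i then (1 : R)
                    else adag (XYB.1 i)).reverse.prod *
                 (List.ofFn fun j => if ∃ c, π' c = j then (1 : R)
                    else a (XYA.2 j)).prod)) *
          (List.ofFn fun j => a (XYB.2 j)).prod) := by
    simp only [FAttachB, Finsupp.sum, Finset.mul_sum, Finset.sum_mul, Finset.smul_sum,
      mul_smul_comm, smul_mul_assoc, smul_smul, mul_assoc]
    simp only [Finset.sum_comm (s := fB.support)]
    simp only [Finset.sum_comm (s := fA.support)]
  rw [hatt, FOp, FOp, FNormal]
  simp only [Finsupp.sum, Finset.sum_mul_sum, ← Finset.sum_add_distrib, ← smul_add]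
  refine Finset.sum_congr rfl fun XYA _ => Finset.sum_congr rfl fun XYB _ => ?_
  rw [smul_mul_smul_comm]
  congr 1
  have hw := prod_mul_prod_eq_add_sum_contraction a adag hccr1 XYB.1 XYA.2
  rw [mul_assoc _ _ (_ * _), ← mul_assoc _ _ (List.prod _), hw, add_mul, mul_add]
  simp only [mul_assoc]
end
end

section
/- Bosonic commutator formula (Theorem 3.1, discrete-mode form): for all n_A, m_A, n_B, m_B ∈ ℕ and all finitely supported kernels f_A : (Fin n_A → ι) × (Fin m_A → ι) → ℂ and f_B : (Fin n_B → ι) × (Fin m_B → ι) → ℂ, one has Op(f_A) * Op(f_B) − Op(f_B) * Op(f_A) = Op(f_A) Γ Op(f_B) − Op(f_B) Γ Op(f_A), where Op(f_B) Γ Op(f_A) is the attached product with the roles of A and B interchanged (sum over 𝒞(m_B, n_A)). -/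
open scoped Classical

noncomputable section

variable {ι : Type*} [DecidableEq ι] {R : Type*} [Ring R] [Algebra ℂ R]

/-- The ordered product `a_{Y 1} ⋯ a_{Y m}` with the factors at positions satisfying `P` omitted. -/
def annihExcept (a : ι → R) {m : ℕ} (Y : Fin m → ι) (P : Fin m → Prop) : R :=
  (List.ofFn fun j => if P j then (1 : R) else a (Y j)).prod

/-- The ordered product `a⁺_{X n} ⋯ a⁺_{X 1}` with the factors at positions satisfying `P`
omitted. -/
def createExcept (adag : ι → R) {n : ℕ} (X : Fin n → ι) (P : Fin n → Prop) : R :=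
  (List.ofFn fun i => if P i then (1 : R) else adag (X i)).reverse.prod

omit [DecidableEq ι] [Algebra ℂ R] in
theorem annihExcept_succ (a : ι → R) {m : ℕ} (Y : Fin (m + 1) → ι) (P : Fin (m + 1) → Prop) :
    annihExcept a Y P =
      (if P 0 then 1 else a (Y 0)) *
        annihExcept a (fun j => Y j.succ) (fun j => P j.succ) := by
  simp [annihExcept, List.ofFn_succ]

omit [DecidableEq ι] [Algebra ℂ R] in
theorem createExcept_succ (adag : ι → R) {n : ℕ} (X : Fin (n + 1) → ι)
    (P : Fin (n + 1) → Prop) :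
    createExcept adag X P =
      (if P (Fin.last n) then 1 else adag (X (Fin.last n))) *
        createExcept adag (fun i => X i.castSucc) (fun i => P i.castSucc) := by
  simp only [createExcept, List.ofFn_succ', List.concat_eq_append, List.reverse_append]
  simp

/-- Commuting a creation operator to the left through a product of annihilation operators. -/
theorem annihExcept_mul_adag (a adag : ι → R)
    (hccr1 : ∀ i j, a i * adag j - adag j * a i = if i = j then 1 else 0)
    {m : ℕ} (Y : Fin m → ι) (P : Fin m → Prop) (x : ι) :
    annihExcept a Y P * adag x = adag x * annihExcept a Y P +
      ∑ j with ¬ P j, (if x = Y j then (1 : ℂ) else 0) •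
        annihExcept a Y (fun k => P k ∨ j = k) := by
  simp only [Finset.sum_filter]
  induction m with
  | zero => simp [annihExcept]
  | succ m ih =>
    rw [annihExcept_succ, mul_assoc, ih, Fin.sum_univ_succ, mul_add, ← mul_assoc]
    have hhead : (if P 0 then 1 else a (Y 0)) * adag x =
        adag x * (if P 0 then 1 else a (Y 0)) +
          if ¬ P 0 then (if x = Y 0 then (1 : R) else 0) else 0 := by
      by_cases h : P 0
      · simp [h]
      · simpa [h, eq_comm (a := x)] using sub_eq_iff_eq_add'.1 (hccr1 (Y 0) x)
    rw [hhead, add_mul, mul_assoc, add_assoc]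
    congr 2
    · by_cases h : P 0 <;> by_cases h' : x = Y 0 <;>
        simp [h, h', annihExcept_succ, (Fin.succ_ne_zero _).symm]
    · rw [Finset.mul_sum]
      refine Finset.sum_congr rfl fun j _ => ?_
      by_cases h : P j.succ <;> by_cases h' : x = Y j.succ <;> simp [h, h', annihExcept_succ]

/-- The sum over all contractions of exactly `C` pairs in the product of annihilation operators
`Y` (positions satisfying `P` being omitted) with creation operators `X`. -/
def contractionSum (a adag : ι → R) {n m : ℕ} (X : Fin n → ι) (Y : Fin m → ι)
    (P : Fin m → Prop) (C : ℕ) : R :=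
  ∑ π : Fin C → Fin n with StrictAnti π,
    ∑ π' : Fin C → Fin m with Function.Injective π' ∧ ∀ c, ¬ P (π' c),
      (∏ c, if X (π c) = Y (π' c) then (1 : ℂ) else 0) •
        (createExcept adag X (fun i => ∃ c, π c = i) *
          annihExcept a Y (fun j => P j ∨ ∃ c, π' c = j))

theorem contractionSum_zero (a adag : ι → R) {n m : ℕ} (X : Fin n → ι) (Y : Fin m → ι)
    (P : Fin m → Prop) :
    contractionSum a adag X Y P 0 =
      createExcept adag X (fun _ => False) * annihExcept a Y P := by
  simp [contractionSum, Finset.filter_true_of_mem, Subsingleton.strictAnti,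
    Function.injective_of_subsingleton]

theorem le_of_strictAnti {C n : ℕ} {π : Fin C → Fin n} (h : StrictAnti π) : C ≤ n := by
  simpa using Fintype.card_le_of_injective π h.injective

theorem contractionSum_of_lt (a adag : ι → R) {n m : ℕ} (X : Fin n → ι) (Y : Fin m → ι)
    (P : Fin m → Prop) {C : ℕ} (hC : min m n < C) : contractionSum a adag X Y P C = 0 := by
  refine Finset.sum_eq_zero fun π hπ => Finset.sum_eq_zero fun π' hπ' => ?_
  simp only [Finset.mem_filter, Finset.mem_univ, true_and] at hπ hπ'
  have h1 := le_of_strictAnti hπ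
  have h2 : C ≤ m := by simpa using Fintype.card_le_of_injective π' hπ'.1
  omega

theorem strictAnti_cons_last {C n : ℕ} {π : Fin C → Fin n} (h : StrictAnti π) :
    StrictAnti (Fin.cons (Fin.last n) (fun c => (π c).castSucc) : Fin (C + 1) → Fin (n + 1)) := by
  intro i j hij
  cases j using Fin.cases with
  | zero => simp at hij
  | succ j =>
    cases i using Fin.cases with
    | zero => simp
    | succ i => simpa using h (Fin.succ_lt_succ_iff.1 hij)

/-- A strictly decreasing sequence in `Fin (n + 1)` either starts at the last element or avoids
it. -/
theorem sum_strictAnti_succ {M : Type*} [AddCommMonoid M] {C n : ℕ}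
    (F : (Fin (C + 1) → Fin (n + 1)) → M) :
    ∑ π with StrictAnti π, F π =
      (∑ π : Fin (C + 1) → Fin n with StrictAnti π, F (fun c => (π c).castSucc)) +
      ∑ π : Fin C → Fin n with StrictAnti π,
        F (Fin.cons (Fin.last n) (fun c => (π c).castSucc)) := by
  refine Eq.trans ?_ (add_comm _ _)
  rw [← Finset.sum_filter_add_sum_filter_not _
    (fun π : Fin (C + 1) → Fin (n + 1) => π 0 = Fin.last n)]
  simp only [Finset.filter_filter]
  congr 1 <;> symm
  · refine Finset.sum_nbij (fun π => Fin.cons (Fin.last n) (fun c => (π c).castSucc))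
      ?_ ?_ ?_ fun _ _ => rfl
    · intro π hπ
      simp only [Finset.mem_filter, Finset.mem_univ, true_and] at hπ ⊢
      exact ⟨strictAnti_cons_last hπ, rfl⟩
    · intro π _ ρ _ h
      funext c
      simpa using congrFun h c.succ
    · intro π hπ
      simp only [Finset.coe_filter, Finset.mem_univ, true_and, Set.mem_ofPred_eq,
        Set.mem_image] at hπ ⊢
      have hne : ∀ c : Fin C, ∃ i : Fin n, i.castSucc = π c.succ := fun c =>
        Fin.exists_castSucc_eq.2 (((hπ.1 c.succ_pos).trans_le (Fin.le_last _)).ne)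
      choose ρ hρ using hne
      refine ⟨ρ, fun i j hij => ?_, ?_⟩
      · have := hπ.1 (Fin.succ_lt_succ_iff.2 hij)
        rwa [← hρ, ← hρ, Fin.castSucc_lt_castSucc_iff] at this
      · funext c
        cases c using Fin.cases with
        | zero => exact hπ.2.symm
        | succ c => exact hρ c
  · refine Finset.sum_nbij (fun π c => (π c).castSucc) ?_ ?_ ?_ fun _ _ => rfl
    · intro π hπ
      simp only [Finset.mem_filter, Finset.mem_univ, true_and] at hπ ⊢
      exact ⟨fun i j hij => Fin.castSucc_lt_castSucc_iff.2 (hπ hij), (Fin.castSucc_lt_last _).ne⟩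
    · intro π _ ρ _ h
      funext c
      simpa using congrFun h c
    · intro π hπ
      simp only [Finset.coe_filter, Finset.mem_univ, true_and, Set.mem_ofPred_eq,
        Set.mem_image] at hπ ⊢
      have hne : ∀ c, ∃ i : Fin n, i.castSucc = π c := fun c =>
        Fin.exists_castSucc_eq.2
          (((hπ.1.antitone (Fin.zero_le c)).trans_lt (Fin.lt_last_iff_ne_last.2 hπ.2)).ne)
      choose ρ hρ using hne
      refine ⟨ρ, fun i j hij => ?_, funext hρ⟩
      have := hπ.1 hij
      rwa [← hρ, ← hρ, Fin.castSucc_lt_castSucc_iff] at this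

/-- An injective sequence avoiding `P` is a first element together with an injective sequence
avoiding both `P` and that element. -/
theorem sum_injective_cons {M : Type*} [AddCommMonoid M] {C m : ℕ} (P : Fin m → Prop)
    (F : (Fin (C + 1) → Fin m) → M) :
    ∑ π' : Fin (C + 1) → Fin m with Function.Injective π' ∧ ∀ c, ¬ P (π' c), F π' =
      ∑ j with ¬ P j,
        ∑ π' : Fin C → Fin m with Function.Injective π' ∧ ∀ c, ¬ (P (π' c) ∨ j = π' c),
          F (Fin.cons j π') := by
  simp only [Finset.sum_filter]
  rw [← (Fin.consEquiv fun _ => Fin m).sum_comp, Fintype.sum_prod_type]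
  refine Finset.sum_congr rfl fun j _ => ?_
  by_cases h : P j
  · simp [h, Fin.forall_fin_succ]
  · rw [if_pos h]
    refine Finset.sum_congr rfl fun π' _ => if_congr ?_ rfl rfl
    have hcons : Fin.consEquiv (fun _ => Fin m) (j, π') = Fin.cons j π' := rfl
    simp only [hcons, Fin.cons_injective_iff, Fin.forall_fin_succ, Fin.cons_zero,
      Fin.cons_succ, h, not_or, forall_and, Set.mem_range, not_exists, eq_comm (a := j)]
    tauto

theorem contractionSum_succ_zero (a adag : ι → R) {n m : ℕ} (X : Fin (n + 1) → ι)
    (Y : Fin m → ι) (P : Fin m → Prop) :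
    contractionSum a adag X Y P 0 =
      adag (X (Fin.last n)) * contractionSum a adag (fun i => X i.castSucc) Y P 0 := by
  simp [contractionSum_zero, createExcept_succ, mul_assoc]

theorem contractionSum_succ_succ (a adag : ι → R) {n m : ℕ} (X : Fin (n + 1) → ι)
    (Y : Fin m → ι) (P : Fin m → Prop) (C : ℕ) :
    contractionSum a adag X Y P (C + 1) =
      adag (X (Fin.last n)) * contractionSum a adag (fun i => X i.castSucc) Y P (C + 1) +
      ∑ j with ¬ P j, (if X (Fin.last n) = Y j then (1 : ℂ) else 0) •
        contractionSum a adag (fun i => X i.castSucc) Y (fun k => P k ∨ j = k) C := by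
  rw [contractionSum, sum_strictAnti_succ]
  congr 1
  · simp only [contractionSum, Finset.mul_sum]
    refine Finset.sum_congr rfl fun π _ => Finset.sum_congr rfl fun π' _ => ?_
    simp [createExcept_succ, (Fin.castSucc_lt_last _).ne, mul_assoc]
  · simp only [contractionSum, Finset.smul_sum]
    refine Eq.trans ?_ Finset.sum_comm
    refine Finset.sum_congr rfl fun π _ => ?_
    rw [sum_injective_cons]
    refine Finset.sum_congr rfl fun j _ => Finset.sum_congr rfl fun π' _ => ?_
    simp [createExcept_succ, Fin.prod_univ_succ, Fin.exists_fin_succ, smul_smul, or_assoc,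
      (Fin.castSucc_lt_last _).ne']

/-- **Wick's theorem** for a product of annihilation operators followed by a product of creation
operators. -/
theorem annihExcept_mul_createExcept (a adag : ι → R)
    (hccr1 : ∀ i j, a i * adag j - adag j * a i = if i = j then 1 else 0)
    {n m : ℕ} (X : Fin n → ι) (Y : Fin m → ι) (P : Fin m → Prop) :
    annihExcept a Y P * createExcept adag X (fun _ => False) =
      ∑ C ∈ Finset.range (n + 1), contractionSum a adag X Y P C := by
  induction n generalizing P with
  | zero => simp [contractionSum_zero, createExcept]
  | succ n ih =>
    rw [Finset.sum_range_succ', contractionSum_succ_zero]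
    simp only [contractionSum_succ_succ, Finset.sum_add_distrib, ← Finset.mul_sum]
    have hlast : contractionSum a adag (fun i => X i.castSucc) Y P (n + 1) = 0 :=
      contractionSum_of_lt _ _ _ _ _ (by omega)
    have hih := ih (fun i => X i.castSucc) P
    rw [← add_zero (∑ C ∈ _, _), ← hlast, ← Finset.sum_range_succ, Finset.sum_range_succ'] at hih
    rw [createExcept_succ, if_neg not_false, ← mul_assoc, annihExcept_mul_adag a adag hccr1,
      add_mul, mul_assoc, hih, mul_add, Finset.sum_mul, Finset.sum_comm, add_right_comm]
    congr 2
    refine Finset.sum_congr rfl fun j _ => ?_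
    rw [smul_mul_assoc, ih, Finset.smul_sum]

/-- Wick's theorem with the uncontracted term split off. -/
theorem annih_mul_create (a adag : ι → R)
    (hccr1 : ∀ i j, a i * adag j - adag j * a i = if i = j then 1 else 0)
    {n m : ℕ} (X : Fin n → ι) (Y : Fin m → ι) :
    (List.ofFn fun j => a (Y j)).prod * (List.ofFn fun i => adag (X i)).reverse.prod =
      (List.ofFn fun i => adag (X i)).reverse.prod * (List.ofFn fun j => a (Y j)).prod +
      ∑ C ∈ Finset.Icc 1 (min m n), contractionSum a adag X Y (fun _ => False) C := by
  have h := annihExcept_mul_createExcept a adag hccr1 X Y (fun _ => False)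
  rw [Finset.range_eq_Ico, Finset.sum_eq_sum_Ico_succ_bot n.succ_pos, contractionSum_zero] at h
  simp only [annihExcept, createExcept, if_false] at h
  rw [h]
  congr 1
  symm
  refine Finset.sum_subset (fun C hC => ?_) fun C hC hC' => contractionSum_of_lt _ _ _ _ _ ?_
  · simp only [Finset.mem_Icc, Finset.mem_Ico] at hC ⊢
    omega
  · simp only [Finset.mem_Icc, Finset.mem_Ico] at hC hC'
    omega

theorem sum_comm_three {α β γ M : Type*} [AddCommMonoid M] (s : Finset α) (t : Finset β)
    (u : Finset γ) (F : α → β → γ → M) :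
    ∑ x ∈ s, ∑ y ∈ t, ∑ z ∈ u, F x y z = ∑ y ∈ t, ∑ z ∈ u, ∑ x ∈ s, F x y z := by
  rw [Finset.sum_comm]
  exact Finset.sum_congr rfl fun _ _ => Finset.sum_comm

theorem FAttachB_eq_sum (a adag : ι → R) {nA mA nB mB : ℕ}
    (fA : ((Fin nA → ι) × (Fin mA → ι)) →₀ ℂ)
    (fB : ((Fin nB → ι) × (Fin mB → ι)) →₀ ℂ) :
    FAttachB a adag fA fB = fA.sum fun XYA cA => fB.sum fun XYB cB =>
      (cA * cB) • ((List.ofFn fun i => adag (XYA.1 i)).reverse.prod *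
        (∑ C ∈ Finset.Icc 1 (min mA nB),
          contractionSum a adag XYB.1 XYA.2 (fun _ => False) C) *
        (List.ofFn fun j => a (XYB.2 j)).prod) := by
  simp only [FAttachB, Finsupp.sum]
  refine ((Finset.sum_congr rfl fun C _ =>
    (Finset.sum_congr rfl fun π _ => sum_comm_three _ _ _ _).trans
      (sum_comm_three _ _ _ _)).trans (sum_comm_three _ _ _ _)).trans ?_
  refine Finset.sum_congr rfl fun A _ => Finset.sum_congr rfl fun B _ => ?_
  simp only [contractionSum, Finset.mul_sum, Finset.sum_mul, Finset.smul_sum]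
  refine Finset.sum_congr rfl fun C _ => Finset.sum_congr rfl fun π _ => ?_
  refine Finset.sum_congr (by simp) fun π' _ => ?_
  simp only [annihExcept, createExcept, smul_smul, mul_assoc, false_or, mul_smul_comm,
    smul_mul_assoc]
  congr!

/-- A product of normal ordered operators is the uncontracted term plus the attached product. -/
theorem FOp_mul_FOp (a adag : ι → R)
    (hccr1 : ∀ i j, a i * adag j - adag j * a i = if i = j then 1 else 0)
    {nA mA nB mB : ℕ}
    (fA : ((Fin nA → ι) × (Fin mA → ι)) →₀ ℂ)
    (fB : ((Fin nB → ι) × (Fin mB → ι)) →₀ ℂ) :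
    FOp a adag fA * FOp a adag fB =
      (fA.sum fun XYA cA => fB.sum fun XYB cB =>
        (cA * cB) • (((List.ofFn fun i => adag (XYA.1 i)).reverse.prod *
          (List.ofFn fun i => adag (XYB.1 i)).reverse.prod) *
          ((List.ofFn fun j => a (XYA.2 j)).prod * (List.ofFn fun j => a (XYB.2 j)).prod))) +
      FAttachB a adag fA fB := by
  rw [FAttachB_eq_sum]
  simp only [FOp, Finsupp.sum, Finset.sum_mul_sum, ← Finset.sum_add_distrib, ← smul_add]
  refine Finset.sum_congr rfl fun A _ => Finset.sum_congr rfl fun B _ => ?_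
  rw [smul_mul_smul_comm]
  congr 1
  have h := annih_mul_create a adag hccr1 B.1 A.2
  set DA := (List.ofFn fun i => adag (A.1 i)).reverse.prod
  set AB := (List.ofFn fun j => a (B.2 j)).prod
  rw [mul_assoc, ← mul_assoc _ _ AB, h]
  simp only [add_mul, mul_add, mul_assoc]

theorem commute_ofFn_prod {α M : Type*} [Monoid M] (b : α → M)
    (hb : ∀ i j, b i * b j = b j * b i) {n m : ℕ} (X : Fin n → α) (Y : Fin m → α) :
    Commute (List.ofFn fun i => b (X i)).prod (List.ofFn fun j => b (Y j)).prod := by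
  refine Commute.list_prod_left _ _ fun x hx => Commute.list_prod_right _ _ fun y hy => ?_
  obtain ⟨i, rfl⟩ := List.mem_ofFn.1 hx
  obtain ⟨j, rfl⟩ := List.mem_ofFn.1 hy
  exact hb _ _

theorem commute_ofFn_reverse_prod {α M : Type*} [Monoid M] (b : α → M)
    (hb : ∀ i j, b i * b j = b j * b i) {n m : ℕ} (X : Fin n → α) (Y : Fin m → α) :
    Commute (List.ofFn fun i => b (X i)).reverse.prod
      (List.ofFn fun j => b (Y j)).reverse.prod := by
  refine Commute.list_prod_left _ _ fun x hx => Commute.list_prod_right _ _ fun y hy => ?_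
  obtain ⟨i, rfl⟩ := List.mem_ofFn.1 (List.mem_reverse.1 hx)
  obtain ⟨j, rfl⟩ := List.mem_ofFn.1 (List.mem_reverse.1 hy)
  exact hb _ _

/-- **Bosonic commutator formula** (Theorem 3.1, discrete-mode form):
if `a, a⁺` satisfy the CCR, then `[Op(f_A), Op(f_B)] = Op(f_A) Γ Op(f_B) − Op(f_B) Γ Op(f_A)`. -/
theorem bosonic_commutator_formula (a adag : ι → R)
    (hccr1 : ∀ i j, a i * adag j - adag j * a i = if i = j then 1 else 0)
    (hccr2 : ∀ i j, a i * a j = a j * a i)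
    (hccr3 : ∀ i j, adag i * adag j = adag j * adag i)
    {nA mA nB mB : ℕ}
    (fA : ((Fin nA → ι) × (Fin mA → ι)) →₀ ℂ)
    (fB : ((Fin nB → ι) × (Fin mB → ι)) →₀ ℂ) :
    FOp a adag fA * FOp a adag fB - FOp a adag fB * FOp a adag fA =
      FAttachB a adag fA fB - FAttachB a adag fB fA := by
  rw [FOp_mul_FOp a adag hccr1 fA fB, FOp_mul_FOp a adag hccr1 fB fA]
  simp only [Finsupp.sum]
  rw [Finset.sum_comm (s := fB.support)]
  rw [← add_sub_add_left_eq_sub (FAttachB a adag fA fB)]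
  congr 2
  refine Finset.sum_congr rfl fun A _ => Finset.sum_congr rfl fun B _ => ?_
  rw [mul_comm (fA A), (commute_ofFn_reverse_prod adag hccr3 A.1 B.1).eq,
    (commute_ofFn_prod a hccr2 A.2 B.2).eq]
end
end

section
/- Sign recursion under adding a top contraction (equation (eq:sgnpi+pi+) in the proof of Lemma 3.4): let m, n ≥ 1, let k ∈ {1,…,m}, and let (π, π') be a pair with π : {1,…,C} → {1,…,n−1} strictly decreasing and π' : {1,…,C} → {1,…,m} injective with k not in the image of π'. Let r_k : {1,…,m}∖{k} → {1,…,m−1} be the unique order-preserving bijection. Define π₊ : {1,…,C+1} → {1,…,n} by π₊(1) = n and π₊(c+1) = π(c), and π'₊ : {1,…,C+1} → {1,…,m} by π'₊(1) = k and π'₊(c+1) = π'(c). Then (π₊, π'₊) is a contraction configuration of size C+1 for (m, n), (π, r_k ∘ π') is a contraction configuration of size C for (m−1, n−1), and sgn(π₊, π'₊, m, n) = (−1)^{m−k} · sgn(π, r_k ∘ π', m−1, n−1). -/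
open scoped Classical

noncomputable section

/-- The unique permutation `σ` of `Fin n` taking the contraction `π` into maximally
crossed form: `σ (π c)` has value `n − 1 − c` (i.e. `σ` sends the `c`-th contracted
connector to the `c`-th top-most position), and `σ` is strictly increasing on the
complement of the range of `π`.  (Defined by choice; for injective `π` such a
permutation exists and is unique.) -/
def maxCrossPerm {n C : ℕ} (π : Fin C → Fin n) : Equiv.Perm (Fin n) :=
  if h : ∃ σ : Equiv.Perm (Fin n),
      (∀ c : Fin C, ((σ (π c) : Fin n) : ℕ) = n - 1 - (c : ℕ)) ∧
      ∀ u₁ u₂ : Fin n, u₁ ∉ Set.range π → u₂ ∉ Set.range π → u₁ < u₂ → σ u₁ < σ u₂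
  then h.choose else 1

/-- The sign `sgn(π, π', m, n) = (−1)^{(m−C)(n−C)} · sign σ · sign σ'` of a contraction
configuration. -/
def configSign {m n C : ℕ} (π : Fin C → Fin n) (π' : Fin C → Fin m) : ℤ :=
  (-1) ^ ((m - C) * (n - C)) *
    ((Equiv.Perm.sign (maxCrossPerm π) : ℤˣ) : ℤ) *
    ((Equiv.Perm.sign (maxCrossPerm π') : ℤˣ) : ℤ)

/-- `σ` takes the contraction `π` into maximally crossed form. -/
def IsMaxCross {n C : ℕ} (π : Fin C → Fin n) (σ : Equiv.Perm (Fin n)) : Prop :=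
  (∀ c : Fin C, ((σ (π c) : Fin n) : ℕ) = n - 1 - (c : ℕ)) ∧
    ∀ u₁ u₂ : Fin n, u₁ ∉ Set.range π → u₂ ∉ Set.range π → u₁ < u₂ → σ u₁ < σ u₂

/-- The permutation of `Fin (n + 1)` sending `k` to the top and acting on the complement of `k`
as `τ`. -/
def topExtend {n : ℕ} (k : Fin (n + 1)) (τ : Equiv.Perm (Fin n)) : Equiv.Perm (Fin (n + 1)) :=
  finSuccEquivLast.symm.permCongr τ.optionCongr * (Fin.cycleIcc k (Fin.last n))⁻¹

theorem topExtend_self {n : ℕ} (k : Fin (n + 1)) (τ : Equiv.Perm (Fin n)) :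
    topExtend k τ k = Fin.last n := by
  have h : (Fin.cycleIcc k (Fin.last n))⁻¹ k = Fin.last n := by
    rw [Equiv.Perm.inv_eq_iff_eq, Fin.cycleIcc_of_last (Fin.le_last k)]
  rw [topExtend, Equiv.Perm.mul_apply, h]
  simp [Equiv.permCongr_apply]

theorem topExtend_succAbove {n : ℕ} (k : Fin (n + 1)) (τ : Equiv.Perm (Fin n)) (i : Fin n) :
    topExtend k τ (k.succAbove i) = (τ i).castSucc := by
  have h : (Fin.cycleIcc k (Fin.last n))⁻¹ (k.succAbove i) = i.castSucc := by
    rw [Equiv.Perm.inv_eq_iff_eq, ← Fin.cycleIcc_comp_succAbove k _ (Fin.le_last k)]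
    simp [-Fin.cycleIcc_def_le]
  rw [topExtend, Equiv.Perm.mul_apply, h]
  simp [Equiv.permCongr_apply]

theorem sign_topExtend {n : ℕ} (k : Fin (n + 1)) (τ : Equiv.Perm (Fin n)) :
    Equiv.Perm.sign (topExtend k τ) = (-1) ^ (n - (k : ℕ)) * Equiv.Perm.sign τ := by
  rw [topExtend, Equiv.Perm.sign_mul, Equiv.Perm.sign_permCongr, Equiv.optionCongr_sign,
    Equiv.Perm.sign_inv, Fin.sign_cycleIcc_of_le (Fin.le_last k), mul_comm, Fin.val_last]

theorem IsMaxCross.cons {n C : ℕ} {ρ : Fin C → Fin n} {τ : Equiv.Perm (Fin n)}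
    (h : IsMaxCross ρ τ) (k : Fin (n + 1)) :
    IsMaxCross (Fin.cons k (fun c => k.succAbove (ρ c)) : Fin (C + 1) → Fin (n + 1))
      (topExtend k τ) := by
  refine ⟨fun c => ?_, fun u₁ u₂ h₁ h₂ hlt => ?_⟩
  · cases c using Fin.cases with
    | zero => simp [topExtend_self]
    | succ c =>
      rw [Fin.cons_succ, topExtend_succAbove, Fin.val_castSucc, h.1 c, Fin.val_succ]
      lia
  · rw [Fin.range_cons, Set.mem_insert_iff, not_or] at h₁ h₂
    obtain ⟨v₁, rfl⟩ := Fin.exists_succAbove_eq h₁.1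
    obtain ⟨v₂, rfl⟩ := Fin.exists_succAbove_eq h₂.1
    rw [topExtend_succAbove, topExtend_succAbove, Fin.castSucc_lt_castSucc_iff]
    refine h.2 v₁ v₂ ?_ ?_ (Fin.succAbove_lt_succAbove_iff.mp hlt)
    · rintro ⟨c, rfl⟩
      exact h₁.2 ⟨c, rfl⟩
    · rintro ⟨c, rfl⟩
      exact h₂.2 ⟨c, rfl⟩

theorem exists_isMaxCross {n C : ℕ} (π : Fin C → Fin n) (hπ : Function.Injective π) :
    ∃ σ, IsMaxCross π σ := by
  induction C generalizing n with
  | zero => exact ⟨1, fun c => c.elim0, fun _ _ _ _ hlt => hlt⟩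
  | succ C ih =>
    obtain _ | n := n
    · exact (π 0).elim0
    have hne (c : Fin C) : π c.succ ≠ π 0 := fun hc => Fin.succ_ne_zero c (hπ hc)
    choose ρ hρ using fun c => Fin.exists_succAbove_eq (hne c)
    have hρ_inj : Function.Injective ρ := fun a b hab =>
      Fin.succ_injective _ (hπ (by rw [← hρ a, ← hρ b, hab]))
    obtain ⟨τ, hτ⟩ := ih ρ hρ_inj
    refine ⟨topExtend (π 0) τ, ?_⟩
    convert hτ.cons (π 0)
    ext c
    cases c using Fin.cases <;> simp [hρ]

theorem IsMaxCross.unique {n C : ℕ} {π : Fin C → Fin n} (hπ : Function.Injective π)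
    {σ₁ σ₂ : Equiv.Perm (Fin n)} (h₁ : IsMaxCross π σ₁) (h₂ : IsMaxCross π σ₂) : σ₁ = σ₂ := by
  have hC : C ≤ n := by simpa using Fintype.card_le_of_injective π hπ
  have top_iff {σ : Equiv.Perm (Fin n)} (h : IsMaxCross π σ) (u : Fin n) :
      u ∈ Set.range π ↔ n - C ≤ (σ u : ℕ) := by
    constructor
    · rintro ⟨c, rfl⟩
      have := h.1 c
      lia
    · intro hu
      refine ⟨⟨n - 1 - (σ u : ℕ), by lia⟩, σ.injective (Fin.ext ?_)⟩
      rw [h.1]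
      simp only
      lia
  have hmono : StrictMono (fun i => σ₁ (σ₂.symm i)) := by
    intro i j hij
    obtain ⟨u, rfl⟩ := σ₂.surjective i
    obtain ⟨v, rfl⟩ := σ₂.surjective j
    simp only [Equiv.symm_apply_apply]
    by_cases hu : u ∈ Set.range π <;> by_cases hv : v ∈ Set.range π
    · obtain ⟨c, rfl⟩ := hu
      obtain ⟨d, rfl⟩ := hv
      rw [Fin.lt_def, h₂.1, h₂.1] at hij
      rwa [Fin.lt_def, h₁.1, h₁.1]
    · rw [top_iff h₂] at hu hv
      lia
    · rw [top_iff h₁] at hu hv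
      lia
    · refine h₁.2 u v hu hv (lt_of_not_ge fun hvu => ?_)
      rcases hvu.lt_or_eq with hlt | rfl
      · exact (h₂.2 v u hv hu hlt).not_gt hij
      · exact hij.false
  have hid (i : Fin n) : σ₁ (σ₂.symm i) = i :=
    congrArg (fun e : Fin n ≃o Fin n => e i) (Subsingleton.elim
      (hmono.orderIsoOfSurjective _ (σ₂.symm.trans σ₁).surjective) (OrderIso.refl _))
  ext u
  simpa using congrArg Fin.val (hid (σ₂ u))

theorem maxCrossPerm_eq {n C : ℕ} {π : Fin C → Fin n} (hπ : Function.Injective π)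
    {σ : Equiv.Perm (Fin n)} (h : IsMaxCross π σ) : maxCrossPerm π = σ := by
  have hex : ∃ σ, IsMaxCross π σ := ⟨σ, h⟩
  have heq : maxCrossPerm π = hex.choose := dif_pos hex
  exact heq ▸ IsMaxCross.unique hπ hex.choose_spec h

theorem sign_maxCrossPerm_cons {n C : ℕ} (k : Fin (n + 1)) {ρ : Fin C → Fin n}
    (hρ : Function.Injective ρ) :
    Equiv.Perm.sign (maxCrossPerm
        (Fin.cons k (fun c => k.succAbove (ρ c)) : Fin (C + 1) → Fin (n + 1))) =
      (-1) ^ (n - (k : ℕ)) * Equiv.Perm.sign (maxCrossPerm ρ) := by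
  obtain ⟨τ, hτ⟩ := exists_isMaxCross ρ hρ
  have hinj : Function.Injective
      (Fin.cons k (fun c => k.succAbove (ρ c)) : Fin (C + 1) → Fin (n + 1)) :=
    Fin.cons_injective_iff.mpr ⟨by rintro ⟨c, hc⟩; exact Fin.succAbove_ne k _ hc,
      Fin.succAbove_right_injective.comp hρ⟩
  rw [maxCrossPerm_eq hinj (hτ.cons k), maxCrossPerm_eq hρ hτ, sign_topExtend]

/-- **Sign recursion under adding a top contraction** (eq. (eq:sgnpi+pi+) in the proof of
Lemma 3.4), stated for the paper's `m, n ≥ 1` as `m + 1, n + 1`.  Here `π` maps into the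
paper's `{1,…,n−1}`, the paper's `k ∈ {1,…,m}` is `k : Fin (m+1)`, the order-preserving
bijection `r_k : {1,…,m}∖{k} → {1,…,m−1}` is encoded through its inverse `Fin.succAbove k`,
so that `ρ = r_k ∘ π'`; `π₊ = (n, π(1), …, π(C))` and `π'₊ = (k, π'(1), …, π'(C))` are
encoded with `Fin.cons`.  Then `(π₊, π'₊)` is a contraction configuration of size `C+1`
for `(m, n)`, `(π, r_k ∘ π')` is one of size `C` for `(m−1, n−1)`, and
`sgn(π₊, π'₊, m, n) = (−1)^{m−k} · sgn(π, r_k ∘ π', m−1, n−1)`. -/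
theorem configSign_cons_top_contraction (m n C : ℕ) (k : Fin (m + 1))
    (π : Fin C → Fin n) (hπ : StrictAnti π)
    (π' : Fin C → Fin (m + 1)) (hπ' : Function.Injective π')
    (hk : k ∉ Set.range π')
    (ρ : Fin C → Fin m) (hρ : ∀ c, Fin.succAbove k (ρ c) = π' c) :
    StrictAnti (Fin.cons (Fin.last n) (fun c => (π c).castSucc) : Fin (C + 1) → Fin (n + 1)) ∧
    Function.Injective (Fin.cons k π' : Fin (C + 1) → Fin (m + 1)) ∧
    C + 1 ≤ min (m + 1) (n + 1) ∧
    Function.Injective ρ ∧ C ≤ min m n ∧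
    configSign (Fin.cons (Fin.last n) (fun c => (π c).castSucc) : Fin (C + 1) → Fin (n + 1))
        (Fin.cons k π' : Fin (C + 1) → Fin (m + 1)) =
      (-1) ^ (m - (k : ℕ)) * configSign π ρ := by
  obtain rfl : π' = fun c => k.succAbove (ρ c) := funext fun c => (hρ c).symm
  have hρ_inj : Function.Injective ρ := fun a b hab => hπ' (congrArg k.succAbove hab)
  have hCn : C ≤ n := by simpa using Fintype.card_le_of_injective π hπ.injective
  have hCm : C ≤ m := by simpa using Fintype.card_le_of_injective ρ hρ_inj
  refine ⟨?_, Fin.cons_injective_iff.mpr ⟨hk, hπ'⟩, by lia, hρ_inj, by lia, ?_⟩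
  · intro a b hab
    cases b using Fin.cases with
    | zero => exact absurd hab (Fin.not_lt_zero a)
    | succ b =>
      cases a using Fin.cases with
      | zero => simp
      | succ a => simpa using hπ (Fin.succ_lt_succ_iff.mp hab)
  · have hlast := sign_maxCrossPerm_cons (Fin.last n) hπ.injective
    simp only [Fin.succAbove_last, Fin.val_last, Nat.sub_self, pow_zero, one_mul] at hlast
    rw [configSign, configSign, hlast, sign_maxCrossPerm_cons k hρ_inj,
      Nat.add_sub_add_right, Nat.add_sub_add_right]
    push_cast
    ring
end
end

section
/- Contraction identity for iterated Laplacian-type derivatives of monomials (equation (eq: coherent) in the coherent-state proof of Lemma 3.3): for all C, n, m ∈ ℕ and all maps I : Fin n → Fin N and J : Fin m → Fin N, one has D^C (P_{I,J}) = Σ_{(π, π')} (∏_{p ∈ Fin C} [I(π(p)) = J(π'(p))]) · (∏_{i not in the range of π} X_{I(i)}) · (∏_{j not in the range of π'} Y_{J(j)}), where the sum runs over all pairs of injective maps π : Fin C → Fin n and π' : Fin C → Fin m, and [P] denotes 1 if P holds and 0 otherwise. -/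
open scoped Classical

noncomputable section

open MvPolynomial

/-- The operator `D = Σ_k ∂_{X_k} ∘ ∂_{Y_k}` on polynomials in the variables
`X_k` (left copy) and `Y_k` (right copy), `k ∈ Fin N`. -/
def Dop (N : ℕ) : Module.End ℂ (MvPolynomial (Fin N ⊕ Fin N) ℂ) :=
  ∑ k : Fin N, (pderiv (Sum.inl k)).toLinearMap ∘ₗ (pderiv (Sum.inr k)).toLinearMap

theorem pderiv_prod_X {σ R ι : Type*} [CommSemiring R] [DecidableEq σ] [DecidableEq ι]
    (k : σ) (s : Finset ι) (f : ι → σ) :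
    pderiv k (∏ i ∈ s, (X (f i) : MvPolynomial σ R)) =
      ∑ a ∈ s, if f a = k then ∏ i ∈ s.erase a, X (f i) else 0 := by
  induction s using Finset.induction_on with
  | empty => simp
  | insert b s hb ih =>
    rw [Finset.prod_insert hb, Derivation.leibniz, ih, Finset.sum_insert hb,
      Finset.erase_insert hb, pderiv_X, Pi.single_apply, add_comm, smul_eq_mul, smul_eq_mul,
      Finset.mul_sum]
    congr 1
    · simp
    · refine Finset.sum_congr rfl fun a ha => ?_
      have hab : a ≠ b := fun h => hb (h ▸ ha)
      rw [Finset.erase_insert_of_ne hab.symm,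
        Finset.prod_insert fun h => hb (Finset.mem_of_mem_erase h), mul_ite, mul_zero]

theorem Dop_prod_mul_prod {N : ℕ} {ι κ : Type*} [DecidableEq ι] [DecidableEq κ]
    (I : ι → Fin N) (J : κ → Fin N) (s : Finset ι) (t : Finset κ) :
    Dop N ((∏ i ∈ s, X (Sum.inl (I i))) * ∏ j ∈ t, X (Sum.inr (J j))) =
      ∑ a ∈ s, ∑ b ∈ t, (if I a = J b then (1 : ℂ) else 0) •
        ((∏ i ∈ s.erase a, X (Sum.inl (I i))) * ∏ j ∈ t.erase b, X (Sum.inr (J j))) := by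
  have h (k : Fin N) : pderiv (Sum.inl k) (pderiv (Sum.inr k)
      ((∏ i ∈ s, (X (Sum.inl (I i)) : MvPolynomial (Fin N ⊕ Fin N) ℂ)) *
        ∏ j ∈ t, X (Sum.inr (J j)))) =
      ∑ a ∈ s, ∑ b ∈ t, if I a = k then if J b = k then
        (∏ i ∈ s.erase a, X (Sum.inl (I i))) * ∏ j ∈ t.erase b, X (Sum.inr (J j))
        else 0 else 0 := by
    rw [Derivation.leibniz, pderiv_prod_X, pderiv_prod_X]
    simp only [reduceCtorEq, if_false, Finset.sum_const_zero, add_zero, smul_eq_mul,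
      Finset.mul_sum, map_sum, Sum.inr.injEq, mul_ite, mul_zero]
    rw [Finset.sum_comm]
    refine Finset.sum_congr rfl fun b _ => ?_
    split_ifs
    · rw [Derivation.leibniz, pderiv_prod_X, pderiv_prod_X]
      simp [Finset.sum_mul, mul_comm (∏ j ∈ t.erase b, _)]
    · simp
  simp only [Dop, LinearMap.sum_apply, LinearMap.comp_apply, Derivation.coeFn_coe, h]
  rw [Finset.sum_comm]
  refine Finset.sum_congr rfl fun a _ => ?_
  rw [Finset.sum_comm]
  refine Finset.sum_congr rfl fun b _ => ?_
  simp [eq_comm]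

theorem sum_filter_injective_succ {α M : Type*} [Fintype α] [DecidableEq α] [AddCommMonoid M] {C : ℕ}
    (F : (Fin (C + 1) → α) → M) :
    ∑ p ∈ Finset.univ.filter (fun p : Fin (C + 1) → α => Function.Injective p), F p =
      ∑ p ∈ Finset.univ.filter (fun p : Fin C → α => Function.Injective p),
        ∑ a ∈ Finset.univ.filter (fun a => a ∉ Set.range p), F (Fin.cons a p) := by
  rw [Finset.sum_sigma']
  refine Finset.sum_bij' (fun p _ => ⟨Fin.tail p, p 0⟩) (fun x _ => Fin.cons x.2 x.1)
    ?_ ?_ ?_ ?_ ?_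
  · intro p hp
    rw [Finset.mem_filter, ← Fin.cons_self_tail p, Fin.cons_injective_iff] at hp
    simpa [and_comm] using hp
  · rintro ⟨p, a⟩ h
    simpa [Fin.cons_injective_iff, and_comm] using h
  all_goals simp

theorem filter_notMem_range_cons {α : Type*} [Fintype α] [DecidableEq α] {C : ℕ}
    (a : α) (p : Fin C → α) :
    Finset.univ.filter (fun i => i ∉ Set.range (Fin.cons a p : Fin (C + 1) → α)) =
      (Finset.univ.filter (fun i => i ∉ Set.range p)).erase a := by
  ext i
  simp [Fin.range_cons]

/-- **Contraction identity for iterated Laplacian-type derivatives of monomials**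
(eq. (eq: coherent) in the coherent-state proof of Lemma 3.3):
`D^C (Π_i X_{I i} · Π_j Y_{J j})` equals the sum over all pairs of injective maps
`π : Fin C → Fin n`, `π' : Fin C → Fin m` of
`(Π_p [I (π p) = J (π' p)]) · Π_{i ∉ range π} X_{I i} · Π_{j ∉ range π'} Y_{J j}`. -/
theorem iterated_derivative_contraction_identity (N C n m : ℕ)
    (I : Fin n → Fin N) (J : Fin m → Fin N) :
    (Dop N ^ C)
        ((∏ i : Fin n, (X (Sum.inl (I i)) : MvPolynomial (Fin N ⊕ Fin N) ℂ)) *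
          ∏ j : Fin m, X (Sum.inr (J j))) =
      ∑ p ∈ Finset.univ.filter
          (fun p : (Fin C → Fin n) × (Fin C → Fin m) =>
            Function.Injective p.1 ∧ Function.Injective p.2),
        (∏ c : Fin C, if I (p.1 c) = J (p.2 c) then (1 : ℂ) else 0) •
          ((∏ i ∈ Finset.univ.filter (fun i => i ∉ Set.range p.1),
              (X (Sum.inl (I i)) : MvPolynomial (Fin N ⊕ Fin N) ℂ)) *
            ∏ j ∈ Finset.univ.filter (fun j => j ∉ Set.range p.2),
              X (Sum.inr (J j))) := by
  have filter_inj (C : ℕ) : Finset.univ.filter (fun p : (Fin C → Fin n) × (Fin C → Fin m) =>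
        Function.Injective p.1 ∧ Function.Injective p.2) =
      Finset.univ.filter (fun p : Fin C → Fin n => Function.Injective p) ×ˢ
        Finset.univ.filter (fun p : Fin C → Fin m => Function.Injective p) := by
    ext p
    simp
  rw [filter_inj, Finset.sum_product]
  induction C with
  | zero => simp [Function.injective_of_subsingleton]
  | succ C ih =>
    rw [pow_succ', Module.End.mul_apply, ih, sum_filter_injective_succ, map_sum]
    refine Finset.sum_congr rfl fun p _ => ?_
    simp only [sum_filter_injective_succ, map_sum, map_smul, Dop_prod_mul_prod]
    rw [Finset.sum_comm]
    refine Finset.sum_congr rfl fun q _ => ?_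
    simp only [Finset.smul_sum]
    refine Finset.sum_congr rfl fun a _ => Finset.sum_congr rfl fun b _ => ?_
    rw [Fin.prod_univ_succ, smul_smul, mul_comm, filter_notMem_range_cons,
      filter_notMem_range_cons]
    simp only [Fin.cons_zero, Fin.cons_succ]
end
end

section
/- Commutator of bosonized annihilation and creation pair operators (second part of equation (eq:approximateCCR)): for all k, k' ∈ ℤ^d and all finitely supported f, g : ℤ^d → ℂ, one has c_k(f) * c⁺_{k'}(g) − c⁺_{k'}(g) * c_k(f) = [k = k'] · (Σ_p conj(f(p)) g(p)) · 1 − [k = −k'] · (Σ_p conj(f(p)) g(p−k)) · 1 − Σ_p conj(f(p)) g(p) · a⁺_{p−k'} * a_{p−k} − Σ_p conj(f(p)) g(p−k+k') · a⁺_{p−k+k'} * a_p + Σ_p conj(f(p)) g(p−k) · a⁺_{p−k−k'} * a_p + Σ_p conj(f(p)) g(p+k') · a⁺_{p+k'} * a_{p−k}, where [P] denotes 1 if P holds and 0 otherwise, and all sums are finite sums over the support of f. -/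
open scoped Classical

noncomputable section

variable {d : ℕ} {R : Type*} [Ring R] [Algebra ℂ R]

/-- Bosonized pair creation operator `c⁺_k(f) = Σ_p f(p) · a⁺_p a⁺_{p−k}`. -/
def cCre (adag : (Fin d → ℤ) → R) (k : Fin d → ℤ) (f : (Fin d → ℤ) →₀ ℂ) : R :=
  f.sum fun p c => c • (adag p * adag (p - k))

/-- Bosonized pair annihilation operator `c_k(f) = Σ_p conj(f(p)) · a_{p−k} a_p`. -/
def cAnn (a : (Fin d → ℤ) → R) (k : Fin d → ℤ) (f : (Fin d → ℤ) →₀ ℂ) : R :=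
  f.sum fun p c => (starRingEnd ℂ c) • (a (p - k) * a p)

/-- The commutator of two quadratic monomials whose factors anticommute up to scalars. -/
theorem pair_commutator_of_anticomm {x y u v : R} {xu xv yu yv : ℂ}
    (hxu : x * u + u * x = xu • (1 : R)) (hxv : x * v + v * x = xv • (1 : R))
    (hyu : y * u + u * y = yu • (1 : R)) (hyv : y * v + v * y = yv • (1 : R)) :
    x * y * (u * v) - u * v * (x * y) =
      (yu * xv) • (1 : R) - (xu * yv) • (1 : R) - yu • (v * x) - xv • (u * y)
        + xu • (v * y) + yv • (u * x) := by
  have expand : x * y * (u * v) - u * v * (x * y) =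
      x * (y * u + u * y) * v - (x * u + u * x) * (y * v + v * y)
        + (x * u + u * x) * (v * y) + u * x * (y * v + v * y)
        - u * (x * v + v * x) * y := by
    noncomm_ring
  have hxv' : x * v = xv • (1 : R) - v * x := eq_sub_of_add_eq hxv
  rw [expand, hxu, hxv, hyu, hyv]
  simp only [mul_smul_comm, smul_mul_assoc, mul_one, one_mul, hxv']
  module

theorem Finsupp.sum_support_smul_ite_smul {α M : Type*} [DecidableEq α] [AddCommGroup M]
    [Module ℂ M]
    (g : α →₀ ℂ) (q₀ : α) (F : α → M) :
    ∑ q ∈ g.support, g q • (if q = q₀ then (1 : ℂ) else 0) • F q = g q₀ • F q₀ := by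
  simp only [ite_smul, one_smul, zero_smul, smul_ite, smul_zero, Finset.sum_ite_eq',
    Finsupp.mem_support_iff, ite_eq_left_iff, not_not]
  intro h
  simp [h]

/-- The commutator of a single pair `a_{p-k} a_p` with a bosonized pair creation operator. -/
theorem pair_commutator_cCre (a adag : (Fin d → ℤ) → R)
    (hcar : ∀ p q, a p * adag q + adag q * a p = if p = q then 1 else 0)
    (k k' p : Fin d → ℤ) (g : (Fin d → ℤ) →₀ ℂ) :
    a (p - k) * a p * cCre adag k' g - cCre adag k' g * (a (p - k) * a p) =
      ((if k = k' then (1 : ℂ) else 0) * g p) • (1 : R)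
      - ((if k = -k' then (1 : ℂ) else 0) * g (p - k)) • (1 : R)
      - g p • (adag (p - k') * a (p - k))
      - g (p - k + k') • (adag (p - k + k') * a p)
      + g (p - k) • (adag (p - k - k') * a p)
      + g (p + k') • (adag (p + k') * a (p - k)) := by
  have hcar' (r s t t' : Fin d → ℤ) (h : r = s ↔ t = t') :
      a r * adag s + adag s * a r = (if t = t' then (1 : ℂ) else 0) • (1 : R) := by
    simp [hcar, h]
  have key (q : Fin d → ℤ) := pair_commutator_of_anticomm
    (hcar' (p - k) q q (p - k) eq_comm)
    (hcar' (p - k) (q - k') q (p - k + k') (by rw [eq_sub_iff_add_eq, eq_comm]))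
    (hcar' p q q p eq_comm)
    (hcar' p (q - k') q (p + k') (by rw [eq_sub_iff_add_eq, eq_comm]))
  have h₁ : (if p = p - k + k' then (1 : ℂ) else 0) = if k = k' then 1 else 0 := by
    refine if_congr ?_ rfl rfl
    rw [sub_add, eq_comm, sub_eq_self, sub_eq_zero]
  have h₂ : (if p - k = p + k' then (1 : ℂ) else 0) = if k = -k' then 1 else 0 := by
    refine if_congr ?_ rfl rfl
    rw [sub_eq_add_neg, add_right_inj, neg_eq_iff_eq_neg]
  have hsum : a (p - k) * a p * cCre adag k' g - cCre adag k' g * (a (p - k) * a p) =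
      g.sum fun q c => c • (a (p - k) * a p * (adag q * adag (q - k'))
        - adag q * adag (q - k') * (a (p - k) * a p)) := by
    simp only [cCre, Finsupp.sum, Finset.mul_sum, Finset.sum_mul, smul_sub,
      Finset.sum_sub_distrib, mul_smul_comm, smul_mul_assoc]
  rw [hsum]
  simp only [key, Finsupp.sum, smul_sub, smul_add, mul_smul, Finset.sum_sub_distrib,
    Finset.sum_add_distrib]
  simp only [Finsupp.sum_support_smul_ite_smul, h₁, h₂]
  simp only [smul_comm (g _)]

/-- **Commutator of bosonized annihilation and creation pair operators** (second part of
eq. (eq:approximateCCR)): if `a, a⁺` satisfy the CAR, then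
`[c_k(f), c⁺_{k'}(g)] = δ_{k,k'} ⟨f,g⟩ − δ_{k,−k'} Σ_p conj(f_p) g_{p−k}
 − Σ_p conj(f_p) g_p a⁺_{p−k'} a_{p−k} − Σ_p conj(f_p) g_{p−k+k'} a⁺_{p−k+k'} a_p
 + Σ_p conj(f_p) g_{p−k} a⁺_{p−k−k'} a_p + Σ_p conj(f_p) g_{p+k'} a⁺_{p+k'} a_{p−k}`. -/
theorem bosonized_pair_commutator (hd : 1 ≤ d)
    (a adag : (Fin d → ℤ) → R)
    (hcar1 : ∀ p q, a p * adag q + adag q * a p = if p = q then 1 else 0)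
    (hcar2 : ∀ p q, a p * a q + a q * a p = 0)
    (hcar3 : ∀ p q, adag p * adag q + adag q * adag p = 0)
    (k k' : Fin d → ℤ) (f g : (Fin d → ℤ) →₀ ℂ) :
    cAnn a k f * cCre adag k' g - cCre adag k' g * cAnn a k f =
      ((if k = k' then (1 : ℂ) else 0) *
          f.sum fun p c => (starRingEnd ℂ c) * g p) • (1 : R)
      - ((if k = -k' then (1 : ℂ) else 0) *
          f.sum fun p c => (starRingEnd ℂ c) * g (p - k)) • (1 : R)
      - (f.sum fun p c => ((starRingEnd ℂ c) * g p) • (adag (p - k') * a (p - k)))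
      - (f.sum fun p c =>
          ((starRingEnd ℂ c) * g (p - k + k')) • (adag (p - k + k') * a p))
      + (f.sum fun p c => ((starRingEnd ℂ c) * g (p - k)) • (adag (p - k - k') * a p))
      + (f.sum fun p c => ((starRingEnd ℂ c) * g (p + k')) • (adag (p + k') * a (p - k))) := by
  have hsum : cAnn a k f * cCre adag k' g - cCre adag k' g * cAnn a k f =
      f.sum fun p c => (starRingEnd ℂ c) • (a (p - k) * a p * cCre adag k' g
        - cCre adag k' g * (a (p - k) * a p)) := by
    simp only [cAnn, Finsupp.sum, Finset.mul_sum, Finset.sum_mul, smul_sub,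
      Finset.sum_sub_distrib, mul_smul_comm, smul_mul_assoc]
  rw [hsum]
  simp only [pair_commutator_cCre a adag hcar1, smul_sub, smul_add, Finsupp.sum,
    Finset.sum_sub_distrib, Finset.sum_add_distrib, Finset.mul_sum, Finset.sum_smul, smul_smul,
    mul_left_comm]
end
end
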